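/- arXiv:1908.02050 — 2 statements merged into one kernel-verified Lean document; each statement's English description precedes it below -/
import Mathlib

section
/- Let G = (V,E) be a finite loopless multigraph and let D, D' be two k-arc-connected orientations of G. For every vertex v with δ⁺_D(v) < δ⁺_{D'}(v), there exists a vertex u with δ⁺_D(u) > δ⁺_{D'}(u) such that λ_D(u,v) > k, i.e., the pair (u,v) is flippable in D (reversing any directed path from u to v in D yields a k-arc-connected orientation). -/
section Defs

variable {V A E : Type*}

/-- A directed walk in the digraph given by `src`/`tgt`, from `u` to `v`,
recorded as its list of arcs. -/
def IsDiwalk (src tgt : A → V) : V → V → List A → Prop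
  | u, v, [] => u = v
  | u, v, a :: p => src a = u ∧ IsDiwalk src tgt (tgt a) v p

/-- A directed path from `u` to `v`: a directed walk whose vertices are pairwise distinct. -/
def IsDipath (src tgt : A → V) (u v : V) (p : List A) : Prop :=
  IsDiwalk src tgt u v p ∧ (u :: p.map tgt).Nodup

/-- A directed cycle: a nonempty closed directed walk whose vertices are pairwise distinct. -/
def IsDicycle (src tgt : A → V) (p : List A) : Prop :=
  p ≠ [] ∧ ∃ u, IsDiwalk src tgt u u p ∧ (p.map tgt).Nodup

/-- Source map of the digraph obtained by reversing the arcs in `B`. -/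
noncomputable def rsrc (src tgt : A → V) (B : Set A) (a : A) : V :=
  haveI := Classical.propDecidable (a ∈ B)
  if a ∈ B then tgt a else src a

/-- Target map of the digraph obtained by reversing the arcs in `B`. -/
noncomputable def rtgt (src tgt : A → V) (B : Set A) (a : A) : V :=
  haveI := Classical.propDecidable (a ∈ B)
  if a ∈ B then src a else tgt a

/-- The outdegree `δ⁺(X)` of a set of vertices: the number of arcs leaving `X`. -/
noncomputable def outdegS (src tgt : A → V) (X : Set V) : ℕ :=
  Nat.card {a : A // src a ∈ X ∧ tgt a ∉ X}

/-- The outdegree `δ⁺(v)` of a vertex: the number of arcs with source `v`. -/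
noncomputable def outdegV (src tgt : A → V) (v : V) : ℕ :=
  Nat.card {a : A // src a = v}

/-- A digraph is `k`-arc-connected if every nonempty proper vertex subset
has outdegree at least `k`. -/
def IsKConnected (src tgt : A → V) (k : ℕ) : Prop :=
  ∀ X : Set V, X.Nonempty → X ≠ Set.univ → k ≤ outdegS src tgt X

/-- `λ(u,v)`: the maximum number of pairwise arc-disjoint directed paths from `u` to `v`
(with value `⊤` when this is unbounded, e.g. for `u = v`). -/
noncomputable def lambdaConn (src tgt : A → V) (u v : V) : ℕ∞ :=
  sSup ((fun m : ℕ => (m : ℕ∞)) '' {m : ℕ | ∃ Ps : Fin m → List A,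
    (∀ i, IsDipath src tgt u v (Ps i)) ∧
    Pairwise fun i j => (Ps i).Disjoint (Ps j)})

/-- An orientation of the multigraph on vertex set `V` with edge set `E` and
endpoint map `ends : E → Sym2 V`. -/
structure GraphOrientation (V : Type*) (E : Type*) (ends : E → Sym2 V) where
  src : E → V
  tgt : E → V
  compat : ∀ e, s(src e, tgt e) = ends e

/-- The orientation obtained from `D` by reversing the arcs in `B`. -/
noncomputable def GraphOrientation.rev {ends : E → Sym2 V} (D : GraphOrientation V E ends) (B : Set E) :
    GraphOrientation V E ends where
  src := rsrc D.src D.tgt B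
  tgt := rtgt D.src D.tgt B
  compat := by
    intro e
    unfold rsrc rtgt
    split
    · rw [Sym2.eq_swap]; exact D.compat e
    · exact D.compat e

end Defs

section Helpers

open Classical Finset

variable {V A : Type*}

theorem aux_suffix (src tgt : A → V) (v : V) (p : List A) : ∀ (x w : V),
    IsDipath src tgt x v p → w ∈ x :: p.map tgt →
    ∃ q : List A, (∀ a ∈ q, a ∈ p) ∧ IsDipath src tgt w v q := by
  induction p with
  | nil =>
    intro x w h hw
    simp at hw
    subst hw
    exact ⟨[], by simp, h⟩
  | cons a p ih =>
    intro x w h hw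
    rcases List.mem_cons.1 hw with rfl | hw
    · exact ⟨a :: p, by simp, h⟩
    · obtain ⟨q, hq, hq'⟩ := ih (tgt a) w ⟨h.1.2, (List.nodup_cons.1 h.2).2⟩ hw
      exact ⟨q, fun b hb => List.mem_cons_of_mem _ (hq b hb), hq'⟩

/-- Either a directed path within `F`, or a separating set. -/
theorem aux_reach (src tgt : A → V) (F : Set A) (u v : V) :
    (∃ p, (∀ a ∈ p, a ∈ F) ∧ IsDipath src tgt u v p) ∨
    ∃ S : Set V, u ∈ S ∧ v ∉ S ∧ ∀ a ∈ F, src a ∈ S → tgt a ∈ S := by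
  by_cases h : ∃ p, (∀ a ∈ p, a ∈ F) ∧ IsDipath src tgt u v p
  · exact Or.inl h
  right
  refine ⟨{w | ¬ ∃ p, (∀ a ∈ p, a ∈ F) ∧ IsDipath src tgt w v p}, h, ?_, ?_⟩
  · intro hv
    exact hv ⟨[], by simp, by simp [IsDipath, IsDiwalk]⟩
  · rintro a ha hs ⟨p, hp, hp'⟩
    apply hs
    by_cases hm : src a ∈ tgt a :: p.map tgt
    · obtain ⟨q, hq, hq'⟩ := aux_suffix src tgt v p _ _ hp' hm
      exact ⟨q, fun b hb => hp b (hq b hb), hq'⟩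
    · refine ⟨a :: p, ?_, ⟨rfl, hp'.1⟩, ?_⟩
      · intro b hb
        rcases List.mem_cons.1 hb with rfl | hb
        · exact ha
        · exact hp b hb
      · exact List.nodup_cons.2 ⟨hm, hp'.2⟩

theorem aux_tele (src tgt : A → V) (φ : V → ℤ) (v : V) (p : List A) : ∀ u,
    IsDiwalk src tgt u v p → (p.map fun a => φ (src a) - φ (tgt a)).sum = φ u - φ v := by
  induction p with
  | nil => intro u h; cases h; simp
  | cons a p ih =>
    intro u h
    simp [ih _ h.2, h.1]

theorem aux_nodup {src tgt : A → V} {u v : V} {p : List A} (h : IsDipath src tgt u v p) :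
    p.Nodup := (List.nodup_cons.1 h.2).2.of_map

theorem aux_tele' (src tgt : A → V) (φ : V → ℤ) (u v : V) (p : List A)
    (h : IsDipath src tgt u v p) :
    ∑ a ∈ p.toFinset, (φ (src a) - φ (tgt a)) = φ u - φ v := by
  rw [List.sum_toFinset _ (aux_nodup h)]
  exact aux_tele src tgt φ v p u h.1

/-- `F` is an integral flow of value `m` from `u` to `v`. -/
def IsFl (src tgt : A → V) (u v : V) (m : ℕ) (F : Finset A) : Prop :=
  ∀ φ : V → ℤ, ∑ a ∈ F, (φ (src a) - φ (tgt a)) = m * (φ u - φ v)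

theorem aux_decomp (src tgt : A → V) (u v : V) (m : ℕ) : ∀ F : Finset A,
    IsFl src tgt u v m F → ∃ Ps : Fin m → List A,
    (∀ i, IsDipath src tgt u v (Ps i)) ∧ (∀ i, ∀ a ∈ Ps i, a ∈ F) ∧
    Pairwise fun i j => (Ps i).Disjoint (Ps j) := by
  induction m with
  | zero => intro F _; exact ⟨fun _ => [], fun i => i.elim0, fun i => i.elim0, fun i => i.elim0⟩
  | succ m ih =>
    intro F hF
    rcases aux_reach src tgt (F : Set A) u v with ⟨p, hpF, hp⟩ | ⟨S, hu, hv, hS⟩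
    · have hsub : p.toFinset ⊆ F := fun a ha => hpF a (List.mem_toFinset.1 ha)
      obtain ⟨Ps, h1, h2, h3⟩ := ih (F \ p.toFinset) (by
        intro φ
        have e1 := hF φ
        have e2 := aux_tele' src tgt φ u v p hp
        have e3 := Finset.sum_sdiff (f := fun a => φ (src a) - φ (tgt a)) hsub
        push_cast at e1
        linarith)
      have hd : ∀ i, (Ps i).Disjoint p := by
        intro i a ha hap
        have := h2 i a ha
        simp at this
        exact this.2 hap
      refine ⟨Fin.cons p Ps, ?_, ?_, ?_⟩
      · intro i
        refine Fin.cases ?_ (fun i => ?_) i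
        · exact hp
        · exact h1 i
      · intro i
        refine Fin.cases ?_ (fun i => ?_) i
        · exact hpF
        · exact fun a ha => (Finset.mem_sdiff.1 (h2 i a ha)).1
      · intro i j
        refine Fin.cases ?_ (fun i => ?_) i <;> refine Fin.cases ?_ (fun j => ?_) j
        · intro h; exact absurd rfl h
        · intro _; exact (hd j).symm
        · intro _; exact hd i
        · intro h
          have hij : i ≠ j := fun e => h (congrArg Fin.succ e)
          exact h3 hij
    · exfalso
      have e := hF (fun w => if w ∈ S then 1 else 0)
      have : ∑ a ∈ F, ((if src a ∈ S then (1:ℤ) else 0) - (if tgt a ∈ S then 1 else 0)) ≤ 0 := by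
        apply Finset.sum_nonpos
        intro a ha
        have := hS a ha
        by_cases h1 : src a ∈ S
        · simp [h1, this h1]
        · simp only [h1, if_false]
          split_ifs <;> simp
      simp only [hu, hv, if_true, if_false] at e
      push_cast at e
      linarith

theorem outdegS_eq [Fintype A] (src tgt : A → V) (X : Set V) :
    (outdegS src tgt X : ℤ) = ∑ a, if src a ∈ X ∧ tgt a ∉ X then (1:ℤ) else 0 := by
  unfold outdegS
  rw [Nat.card_eq_fintype_card, Fintype.card_subtype]
  simp

theorem outdegV_eq [Fintype A] (src tgt : A → V) (v : V) :
    (outdegV src tgt v : ℤ) = ∑ a, if src a = v then (1:ℤ) else 0 := by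
  unfold outdegV
  rw [Nat.card_eq_fintype_card, Fintype.card_subtype]
  simp

theorem aux_ind [Fintype A] (F : Finset A) (f : A → ℤ) :
    ∑ a, (if a ∈ F then f a else 0) = ∑ a ∈ F, f a := by
  simp

theorem aux_flow [Fintype A] (src tgt : A → V) (u v : V) (m : ℕ)
    (hc : ∀ S : Set V, u ∈ S → v ∉ S → m ≤ outdegS src tgt S) :
    ∃ F, IsFl src tgt u v m F := by
  induction m with
  | zero => exact ⟨∅, fun φ => by simp⟩
  | succ m ih =>
    obtain ⟨F, hF⟩ := ih fun S h1 h2 => (Nat.le_succ m).trans (hc S h1 h2)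
    rcases aux_reach (rsrc src tgt (F : Set A)) (rtgt src tgt (F : Set A)) Set.univ u v with
      ⟨p, -, hp⟩ | ⟨S, hu, hv, hS⟩
    · refine ⟨symmDiff F p.toFinset, fun φ => ?_⟩
      have e1 := hF φ
      have e2 := aux_tele' _ _ φ u v p hp
      have e3 : ∑ a ∈ symmDiff F p.toFinset, (φ (src a) - φ (tgt a)) =
          ∑ a ∈ F, (φ (src a) - φ (tgt a)) + ∑ a ∈ p.toFinset,
            (φ (rsrc src tgt (F : Set A) a) - φ (rtgt src tgt (F : Set A) a)) := by
        rw [← aux_ind F, ← aux_ind p.toFinset,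
          ← aux_ind (symmDiff F p.toFinset), ← Finset.sum_add_distrib]
        apply Finset.sum_congr rfl
        intro a _
        by_cases h1 : a ∈ F <;> by_cases h2 : a ∈ p.toFinset <;>
          simp [h1, h2, rsrc, rtgt, Finset.mem_symmDiff]
      rw [e3, e1, e2]
      push_cast
      ring
    · exfalso
      have e := hF (fun w => if w ∈ S then 1 else 0)
      have h := hc S hu hv
      have h' : ((m + 1 : ℕ) : ℤ) ≤ outdegS src tgt S := by exact_mod_cast h
      rw [outdegS_eq] at h'
      have : ∑ a, (if src a ∈ S ∧ tgt a ∉ S then (1:ℤ) else 0) ≤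
         ∑ a ∈ F, ((if src a ∈ S then (1:ℤ) else 0) - (if tgt a ∈ S then 1 else 0)) := by
        rw [← aux_ind F]
        apply Finset.sum_le_sum
        intro a _
        have := hS a trivial
        by_cases h1 : a ∈ F <;> by_cases h2 : src a ∈ S <;> by_cases h3 : tgt a ∈ S <;>
          simp_all [rsrc, rtgt]
      simp only [hu, hv, if_true, if_false] at e
      push_cast at h'
      linarith

theorem aux_menger [Fintype A] (src tgt : A → V) (u v : V) (m : ℕ)
    (hc : ∀ S : Set V, u ∈ S → v ∉ S → m ≤ outdegS src tgt S) :
    (m : ℕ∞) ≤ lambdaConn src tgt u v := by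
  obtain ⟨F, hF⟩ := aux_flow src tgt u v m hc
  obtain ⟨Ps, h1, _, h3⟩ := aux_decomp src tgt u v m F hF
  exact le_sSup ⟨m, ⟨Ps, h1, h3⟩, rfl⟩

theorem aux_submod [Fintype A] (src tgt : A → V) (X Y : Set V) :
    (outdegS src tgt (X ∩ Y) : ℤ) + outdegS src tgt (X ∪ Y) ≤
      outdegS src tgt X + outdegS src tgt Y := by
  simp only [outdegS_eq, ← Finset.sum_add_distrib]
  apply Finset.sum_le_sum
  intro a _
  by_cases h1 : src a ∈ X <;> by_cases h2 : src a ∈ Y <;> by_cases h3 : tgt a ∈ X <;>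
    by_cases h4 : tgt a ∈ Y <;> simp [h1, h2, h3, h4]

theorem aux_degsum [Fintype A] (src tgt : A → V) (X : Finset V) :
    ∑ w ∈ X, (outdegV src tgt w : ℤ) = outdegS src tgt (X : Set V) +
      ∑ a, if src a ∈ X ∧ tgt a ∈ X then (1:ℤ) else 0 := by
  simp only [outdegS_eq, outdegV_eq]
  rw [Finset.sum_comm, ← Finset.sum_add_distrib]
  apply Finset.sum_congr rfl
  intro a _
  by_cases h1 : src a ∈ X <;> by_cases h2 : tgt a ∈ X <;> simp [h1, h2]

theorem aux_diff [Fintype A] {ends : A → Sym2 V} (D D' : GraphOrientation V A ends)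
    (X : Finset V) :
    ∑ w ∈ X, ((outdegV D.src D.tgt w : ℤ) - outdegV D'.src D'.tgt w) =
      outdegS D.src D.tgt (X : Set V) - outdegS D'.src D'.tgt (X : Set V) := by
  rw [Finset.sum_sub_distrib, aux_degsum, aux_degsum]
  have : ∀ a, (D.src a ∈ X ∧ D.tgt a ∈ X) ↔ (D'.src a ∈ X ∧ D'.tgt a ∈ X) := by
    intro a
    have h := (D.compat a).trans (D'.compat a).symm
    rcases Sym2.eq_iff.1 h with ⟨h1, h2⟩ | ⟨h1, h2⟩
    · rw [h1, h2]
    · rw [h1, h2, and_comm]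
  simp only [this]
  ring

end Helpers

open Classical in
/-- For two `k`-arc-connected orientations `D, D'` of a finite loopless
multigraph and a vertex `v` with `δ⁺_D(v) < δ⁺_{D'}(v)`, there is a vertex `u` with
`δ⁺_D(u) > δ⁺_{D'}(u)` such that `λ_D(u,v) > k`, i.e. `(u,v)` is flippable in `D`. -/
theorem aux_main {V E : Type*} [Fintype V] [Fintype E]
    (ends : E → Sym2 V) (k : ℕ)
    (D D' : GraphOrientation V E ends)
    (hD : IsKConnected D.src D.tgt k) (hD' : IsKConnected D'.src D'.tgt k)
    (v : V) (hv : outdegV D.src D.tgt v < outdegV D'.src D'.tgt v) :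
    ∃ u : V, outdegV D'.src D'.tgt u < outdegV D.src D.tgt u ∧
      (k : ℕ∞) < lambdaConn D.src D.tgt u v := by
  by_contra hcon
  push Not at hcon
  let T : Finset V → Prop := fun X => v ∉ X ∧ outdegS D.src D.tgt (X : Set V) = k
  have hne : ∀ X : Finset V, v ∉ X → (X : Set V) ≠ Set.univ := by
    intro X hX h
    exact hX (by have : v ∈ (X : Set V) := h ▸ Set.mem_univ v
                 exact_mod_cast this)
  have hcov : ∀ u, outdegV D'.src D'.tgt u < outdegV D.src D.tgt u → ∃ X, T X ∧ u ∈ X := by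
    intro u hu
    have h1 := hcon u hu
    by_contra hno
    push Not at hno
    have := aux_menger D.src D.tgt u v (k+1) (by
      intro S huS hvS
      have hS : ((S.toFinset : Finset V) : Set V) = S := Set.coe_toFinset S
      have hge := hD S ⟨u, huS⟩ (fun h => hvS (h ▸ Set.mem_univ v))
      rcases Nat.lt_or_eq_of_le hge with h | h
      · exact h
      · exact absurd (by simpa using huS)
          (hno S.toFinset ⟨by simpa using hvS, by rw [hS]; exact h.symm⟩))
    have h2 := this.trans h1
    have h3 : k + 1 ≤ k := by exact_mod_cast h2
    omega
  have hun : ∀ X Y, T X → T Y → (X ∩ Y).Nonempty → T (X ∪ Y) := by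
    intro X Y hX hY hXY
    have hvU : v ∉ X ∪ Y := by simp [hX.1, hY.1]
    refine ⟨hvU, ?_⟩
    have h1 := aux_submod D.src D.tgt (X : Set V) (Y : Set V)
    have h2 := hD ((X : Set V) ∩ Y) (by exact_mod_cast hXY)
      (by rw [← Finset.coe_inter]; exact hne _ (by simp [hX.1]))
    have h3 := hD ((X : Set V) ∪ Y) (by
      obtain ⟨x, hx⟩ := hXY
      exact ⟨x, Or.inl (by simpa using (Finset.mem_inter.1 hx).1)⟩)
      (by rw [← Finset.coe_union]; exact hne _ hvU)
    rw [hX.2, hY.2] at h1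
    rw [Finset.coe_union]
    omega
  let U : Finset V := Finset.univ.filter fun w => ∃ X, T X ∧ w ∈ X
  have hmax : ∀ w, ∃ M : Finset V, w ∈ U → (T M ∧ w ∈ M ∧ ∀ X, T X → w ∈ X → X ⊆ M) := by
    intro w
    by_cases hw : w ∈ U
    · have hw' : ∃ X, T X ∧ w ∈ X := by simpa [U] using hw
      obtain ⟨X0, hX0⟩ := hw'
      obtain ⟨M, hM, hMm⟩ := Finset.exists_max_image
        (Finset.univ.filter fun X : Finset V => T X ∧ w ∈ X) Finset.card ⟨X0, by simpa using hX0⟩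
      simp only [Finset.mem_filter, Finset.mem_univ, true_and] at hM hMm
      refine ⟨M, fun _ => ⟨hM.1, hM.2, fun X hX hwX => ?_⟩⟩
      have h1 := hun M X hM.1 hX ⟨w, by simp [hM.2, hwX]⟩
      have h2 := hMm (M ∪ X) ⟨h1, by simp [hM.2]⟩
      have h3 := Finset.eq_of_subset_of_card_le (Finset.subset_union_left (s₁ := M) (s₂ := X)) h2
      rw [h3]
      exact Finset.subset_union_right
    · exact ⟨∅, fun h => absurd h hw⟩
  choose M hM using hmax
  let h : V → ℤ := fun w => (outdegV D.src D.tgt w : ℤ) - outdegV D'.src D'.tgt w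
  have hT : ∀ X, T X → X.Nonempty → ∑ w ∈ X, h w ≤ 0 := by
    intro X hX hXn
    have e := aux_diff D D' X
    have h1 := hD' (X : Set V) (by exact_mod_cast hXn) (hne X hX.1)
    have h2 := hX.2
    simp only [h]
    rw [e]
    omega
  have hU : ∑ w ∈ U, h w ≤ 0 := by
    rw [← Finset.sum_fiberwise_of_maps_to (t := U.image M) (g := M)
      (fun w hw => Finset.mem_image_of_mem M hw)]
    apply Finset.sum_nonpos
    intro X hX
    obtain ⟨w0, hw0, rfl⟩ := Finset.mem_image.1 hX
    obtain ⟨a1, a2, a3⟩ := hM w0 hw0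
    have : U.filter (fun w => M w = M w0) = M w0 := by
      ext w
      constructor
      · intro hw
        obtain ⟨b1, b2⟩ := Finset.mem_filter.1 hw
        rw [← b2]
        exact (hM w b1).2.1
      · intro hw
        have hwU : w ∈ U := by simpa [U] using ⟨M w0, a1, hw⟩
        obtain ⟨c1, c2, c3⟩ := hM w hwU
        have d1 := c3 _ a1 hw
        exact Finset.mem_filter.2 ⟨hwU, (a3 _ c1 (d1 a2)).antisymm d1⟩
    rw [this]
    exact hT _ a1 ⟨w0, a2⟩
  have hUc : ∑ w ∈ Finset.univ \ U, h w < 0 := by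
    have hle : ∀ w ∈ Finset.univ \ U, h w ≤ 0 := by
      intro w hw
      by_contra hlt
      have : outdegV D'.src D'.tgt w < outdegV D.src D.tgt w := by
        simp only [h] at hlt
        omega
      have := hcov w this
      simp only [U, Finset.mem_sdiff, Finset.mem_filter, Finset.mem_univ, true_and] at hw
      exact hw this
    have hvU : v ∈ Finset.univ \ U := by
      simp only [U, Finset.mem_sdiff, Finset.mem_filter, Finset.mem_univ, true_and]
      rintro ⟨X, hX, hvX⟩
      exact hX.1 hvX
    have : ∑ w ∈ Finset.univ \ U, h w < ∑ w ∈ Finset.univ \ U, (0:ℤ) :=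
      Finset.sum_lt_sum hle ⟨v, hvU, by simp only [h]; omega⟩
    simpa using this
  have htot : ∑ w, h w = 0 := by
    have e := aux_diff D D' Finset.univ
    simp only [h]
    rw [e]
    simp [outdegS_eq]
  have := Finset.sum_sdiff (f := h) (Finset.subset_univ U)
  linarith

/-- For two `k`-arc-connected orientations `D, D'` of a finite loopless
multigraph and a vertex `v` with `δ⁺_D(v) < δ⁺_{D'}(v)`, there is a vertex `u` with
`δ⁺_D(u) > δ⁺_{D'}(u)` such that `λ_D(u,v) > k`, i.e. `(u,v)` is flippable in `D`. -/
theorem stmt_8 {V E : Type*} [Fintype V] [Fintype E]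
    (ends : E → Sym2 V) (hloop : ∀ e, ¬ (ends e).IsDiag) (k : ℕ)
    (D D' : GraphOrientation V E ends)
    (hD : IsKConnected D.src D.tgt k) (hD' : IsKConnected D'.src D'.tgt k)
    (v : V) (hv : outdegV D.src D.tgt v < outdegV D'.src D'.tgt v) :
    ∃ u : V, outdegV D'.src D'.tgt u < outdegV D.src D.tgt u ∧
      (k : ℕ∞) < lambdaConn D.src D.tgt u v := by
  exact aux_main ends k D D' hD hD' v hv
end

section
/- Let G = (V,E) be a finite loopless multigraph, α : V → ℕ, let D = (V,A) be an α-orientation of G, let F ⊆ A, and let a = (u,v) ∈ A \ F. If there is no directed path from v to u in D \ F (the digraph D with the arcs of F removed), then there exists no α-orientation of G that agrees with D on all arcs of F and orients the edge underlying a as (v,u). -/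
theorem dipath_suffix {V A : Type*} (src tgt : A → V) (u w : V) :
    ∀ (q : List A) (x : V), IsDipath src tgt x w q → u ∈ x :: q.map tgt →
      ∃ q', IsDipath src tgt u w q' ∧ ∀ b ∈ q', b ∈ q := by
  intro q
  induction q with
  | nil =>
    intro x h hu
    simp at hu
    subst hu
    exact ⟨[], h, by simp⟩
  | cons b q ih =>
    intro x h hu
    rcases List.mem_cons.1 hu with rfl | hu
    · exact ⟨_, h, fun _ h => h⟩
    · have h2 : IsDipath src tgt (tgt b) w q := ⟨h.1.2, (List.nodup_cons.1 h.2).2⟩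
      obtain ⟨q', h3, h4⟩ := ih _ h2 hu
      exact ⟨q', h3, fun c hc => List.mem_cons_of_mem _ (h4 c hc)⟩

theorem diwalk_dipath {V A : Type*} (src tgt : A → V) (w : V) :
    ∀ (p : List A) (u : V), IsDiwalk src tgt u w p →
      ∃ q, IsDipath src tgt u w q ∧ ∀ b ∈ q, b ∈ p := by
  intro p
  induction p with
  | nil =>
    intro u h
    exact ⟨[], ⟨h, by simp⟩, by simp⟩
  | cons b p ih =>
    intro u h
    obtain ⟨q, hq, hs⟩ := ih _ h.2
    by_cases hu : u ∈ tgt b :: q.map tgt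
    · obtain ⟨q', h3, h4⟩ := dipath_suffix src tgt u w q _ hq hu
      exact ⟨q', h3, fun c hc => List.mem_cons_of_mem _ (hs c (h4 c hc))⟩
    · refine ⟨b :: q, ⟨⟨h.1, hq.1⟩, List.nodup_cons.2 ⟨hu, hq.2⟩⟩, ?_⟩
      intro c hc
      rcases List.mem_cons.1 hc with rfl | hc
      · simp
      · exact List.mem_cons_of_mem _ (hs c hc)

theorem diwalk_snoc {V A : Type*} (src tgt : A → V) (b : A) :
    ∀ (p : List A) (u : V), IsDiwalk src tgt u (src b) p →
      IsDiwalk src tgt u (tgt b) (p ++ [b]) := by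
  intro p
  induction p with
  | nil => intro u h; exact ⟨Eq.symm h, rfl⟩
  | cons c p ih => intro u h; exact ⟨h.1, ih _ h.2⟩

open Classical in
theorem card_src_mem {V E : Type*} [Fintype V] [Fintype E] (src tgt : E → V) (X : Set V) :
    (Finset.univ.filter fun e => src e ∈ X).card
      = ∑ v ∈ Finset.univ.filter (fun v => v ∈ X), outdegV src tgt v := by
  rw [Finset.card_eq_sum_card_fiberwise (f := src)
    (t := Finset.univ.filter (fun v => v ∈ X)) (by intro e he; simpa using he)]
  refine Finset.sum_congr rfl fun v hv => ?_
  rw [outdegV, Nat.card_eq_fintype_card, Fintype.card_subtype, Finset.filter_filter]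
  congr 1
  ext e
  simp at hv ⊢
  rintro rfl
  exact hv

/-- Let `D` be an `α`-orientation, `F` a set of fixed arcs and
`a = (u,v) ∉ F`. If there is no directed path from `v` to `u` in `D \ F`, then no
`α`-orientation agrees with `D` on `F` and orients the edge underlying `a` as `(v,u)`. -/
theorem stmt_16 {V E : Type*} [Fintype V] [Fintype E]
    (ends : E → Sym2 V) (hloop : ∀ e, ¬ (ends e).IsDiag)
    (α : V → ℕ) (D : GraphOrientation V E ends)
    (hD : ∀ v, outdegV D.src D.tgt v = α v)
    (F : Set E) (a : E) (ha : a ∉ F)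
    (hnopath : ¬ ∃ p : List E,
      IsDipath D.src D.tgt (D.tgt a) (D.src a) p ∧ ∀ b ∈ p, b ∉ F) :
    ¬ ∃ D' : GraphOrientation V E ends,
        (∀ v, outdegV D'.src D'.tgt v = α v) ∧
        (∀ e ∈ F, D'.src e = D.src e ∧ D'.tgt e = D.tgt e) ∧
        D'.src a = D.tgt a ∧ D'.tgt a = D.src a := by
  classical
  rintro ⟨D', hD', hF, ha1, ha2⟩
  let X : Set V := {w | ∃ p, IsDiwalk D.src D.tgt (D.tgt a) w p ∧ ∀ b ∈ p, b ∉ F}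
  have hu : D.src a ∉ X := by
    rintro ⟨p, hp, hpF⟩
    obtain ⟨q, hq, hs⟩ := diwalk_dipath _ _ _ p _ hp
    exact hnopath ⟨q, hq, fun b hb => hpF b (hs b hb)⟩
  have hv : D.tgt a ∈ X := ⟨[], rfl, by simp⟩
  have hcl : ∀ e, e ∉ F → D.src e ∈ X → D.tgt e ∈ X := by
    rintro e he ⟨p, hp, hpF⟩
    refine ⟨p ++ [e], diwalk_snoc _ _ e p _ hp, ?_⟩
    intro b hb
    rcases List.mem_append.1 hb with hb | hb
    · exact hpF b hb
    · rw [List.mem_singleton.1 hb]; exact he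
  have hlt : (Finset.univ.filter fun e => D.src e ∈ X).card
      < (Finset.univ.filter fun e => D'.src e ∈ X).card := by
    apply Finset.card_lt_card
    rw [Finset.ssubset_iff_of_subset]
    · exact ⟨a, by simp [ha1, hv], by simp [hu]⟩
    · intro e he
      simp only [Finset.mem_filter, Finset.mem_univ, true_and] at he ⊢
      by_cases heF : e ∈ F
      · rw [(hF e heF).1]; exact he
      · have h := (D'.compat e).trans (D.compat e).symm
        rcases Sym2.eq_iff.1 h with h | h
        · rw [h.1]; exact he
        · rw [h.1]; exact hcl e heF he
  rw [card_src_mem D.src D.tgt, card_src_mem D'.src D'.tgt] at hlt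
  simp [hD, hD'] at hlt
end
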